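/- The assignment γ(k_j + K) := p_j + P for j = 1, 2, 3 extends to a well-defined group isomorphism γ : K*/K → P*/P satisfying q_P(γ(x)) = −q_K(x) for all x ∈ K*/K. Moreover, the glued lattice Γ := {(k,p) ∈ K* ⊕ P* : γ(k + K) = p + P}, equipped with the bilinear form ⟨(k,p),(k',p')⟩ := ⟨k,k'⟩ + ⟨p,p'⟩, is an even unimodular lattice of rank 22 and signature (3,19). -/

import Mathlib

noncomputable section

abbrev F3 : Type := ZMod 3 × ZMod 3
abbrev IP : Type := F3 × Fin 2
abbrev VP : Type := IP → ℚ

/-- The basis vectors `E_t^(k)` (with `k : Fin 2` corresponding to `k+1 ∈ {1,2}`). -/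
def Ev (t : F3) (k : Fin 2) : VP := Pi.single (t, k) 1

/-- Gram coefficients of the bilinear form on `V`. -/
def GP : IP → IP → ℚ := fun i j =>
  if i.1 = j.1 then (if i.2 = j.2 then -2 else 1) else 0

/-- The symmetric bilinear form on `V`. -/
def BP (x y : VP) : ℚ := ∑ i : IP, ∑ j : IP, x i * GP i j * y j

lemma BP_add_left (a b x : VP) : BP (a + b) x = BP a x + BP b x := by
  simp only [BP, Pi.add_apply, add_mul, Finset.sum_add_distrib]

lemma BP_zsmul_left (c : ℤ) (a x : VP) : BP (c • a) x = c * BP a x := by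
  simp only [BP, Pi.smul_apply, zsmul_eq_mul, Finset.mul_sum, mul_assoc]

lemma BP_zero_left (x : VP) : BP 0 x = 0 := by
  simp [BP]

/-- `E_t := E_t^(1) + 2·E_t^(2)`. -/
def EV (t : F3) : VP := Ev t 0 + 2 • Ev t 1

/-- The affine line in `𝔽₃²` through `p` with direction `d`. -/
def lineF (p d : F3) : Finset F3 := Finset.image (fun s : ZMod 3 => p + s • d) Finset.univ

def IsLine (L : Finset F3) : Prop := ∃ p d : F3, d ≠ 0 ∧ L = lineF p d

def AreParallel (L L' : Finset F3) : Prop :=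
  ∃ p p' d : F3, d ≠ 0 ∧ L = lineF p d ∧ L' = lineF p' d

/-- `e(L) := (1/3)·∑_{t∈L} E_t`. -/
def eL (L : Finset F3) : VP := (3 : ℚ)⁻¹ • ∑ t ∈ L, EV t

/-- Generators of the root lattice `R` of type `A₂⁹`. -/
def Rgen : Set VP := {x | ∃ t k, x = Ev t k}

/-- The root lattice `R`. -/
def Rlat : Submodule ℤ VP := Submodule.span ℤ Rgen

/-- The lattice `P`. -/
def Plat : Submodule ℤ VP :=
  Submodule.span ℤ (Rgen ∪ {x | ∃ L L', AreParallel L L' ∧ x = eL L - eL L'})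

/-- The dual lattice `Λ* = {v | ⟨v,λ⟩ ∈ ℤ for all λ ∈ Λ}`. -/
def dualP (Λ : Submodule ℤ VP) : Submodule ℤ VP where
  carrier := {v | ∀ x ∈ Λ, ∃ n : ℤ, BP v x = n}
  zero_mem' := fun x _ => ⟨0, by simp [BP_zero_left]⟩
  add_mem' := by
    intro a b ha hb x hx
    obtain ⟨n, hn⟩ := ha x hx
    obtain ⟨m, hm⟩ := hb x hx
    exact ⟨n + m, by rw [BP_add_left, hn, hm]; push_cast; ring⟩
  smul_mem' := by
    intro c v hv x hx
    obtain ⟨n, hn⟩ := hv x hx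
    exact ⟨c * n, by rw [BP_zsmul_left, hn]; push_cast; ring⟩

def L12 : Finset F3 := lineF (0, 0) (0, 1)
def L34 : Finset F3 := lineF (0, 0) (1, 0)
def L00 : Finset F3 := lineF (0, 0) (1, 1)

def p1 : VP := eL L34 + eL L00
def p2 : VP := eL L12 + eL L34
def p3 : VP := eL L12 + eL L00

def pv : Fin 3 → VP := ![p1, p2, p3]


abbrev VK : Type := Fin 4 → ℚ

/-- The basis `(κ₁, κ₂, κ₃, κ₄)` of `K`. -/
def kappa (i : Fin 4) : VK := Pi.single i 1

/-- The Gram matrix of the bilinear form on `K`. -/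
def GK : Matrix (Fin 4) (Fin 4) ℚ := !![2, 1, 0, 0; 1, 2, 0, 0; 0, 0, 0, 3; 0, 0, 3, 0]

/-- The symmetric bilinear form on `K ⊗ ℚ`. -/
def BK (x y : VK) : ℚ := ∑ i : Fin 4, ∑ j : Fin 4, x i * GK i j * y j

lemma BK_add_left (a b x : VK) : BK (a + b) x = BK a x + BK b x := by
  simp only [BK, Pi.add_apply, add_mul, Finset.sum_add_distrib]

lemma BK_zsmul_left (c : ℤ) (a x : VK) : BK (c • a) x = c * BK a x := by
  simp only [BK, Pi.smul_apply, zsmul_eq_mul, Finset.mul_sum, mul_assoc]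

lemma BK_zero_left (x : VK) : BK 0 x = 0 := by
  simp [BK]

/-- The lattice `K = ℤκ₁ ⊕ ℤκ₂ ⊕ ℤκ₃ ⊕ ℤκ₄`. -/
def Klat : Submodule ℤ VK := Submodule.span ℤ (Set.range kappa)

/-- The dual lattice `Λ* = {v | ⟨v,λ⟩ ∈ ℤ for all λ ∈ Λ}`. -/
def dualK (Λ : Submodule ℤ VK) : Submodule ℤ VK where
  carrier := {v | ∀ x ∈ Λ, ∃ n : ℤ, BK v x = n}
  zero_mem' := fun x _ => ⟨0, by simp [BK_zero_left]⟩
  add_mem' := by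
    intro a b ha hb x hx
    obtain ⟨n, hn⟩ := ha x hx
    obtain ⟨m, hm⟩ := hb x hx
    exact ⟨n + m, by rw [BK_add_left, hn, hm]; push_cast; ring⟩
  smul_mem' := by
    intro c v hv x hx
    obtain ⟨n, hn⟩ := hv x hx
    exact ⟨c * n, by rw [BK_zsmul_left, hn]; push_cast; ring⟩

/-- `k₁ := (1/3)(2κ₁ − κ₂ + κ₃ + κ₄)`. -/
def k1 : VK := (3 : ℚ)⁻¹ • (2 • kappa 0 - kappa 1 + kappa 2 + kappa 3)

/-- `k₂ := (1/3)(κ₃ − κ₄)`. -/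
def k2 : VK := (3 : ℚ)⁻¹ • (kappa 2 - kappa 3)

/-- `k₃ := (1/3)(2κ₁ − κ₂ − κ₃ − κ₄)`. -/
def k3 : VK := (3 : ℚ)⁻¹ • (2 • kappa 0 - kappa 1 - kappa 2 - kappa 3)

def kv : Fin 3 → VK := ![k1, k2, k3]


/-- The bilinear form on `(K ⊕ P) ⊗ ℚ`. -/
def Bf (v w : VK × VP) : ℚ := BK v.1 w.1 + BP v.2 w.2

/-- The discriminant group `K*/K`, realized as the image of `K*` in `(K⊗ℚ)/K`. -/
def DK : Submodule ℤ (VK ⧸ Klat) := Submodule.map Klat.mkQ (dualK Klat)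

/-- The discriminant group `P*/P`, realized as the image of `P*` in `(P⊗ℚ)/P`. -/
def DP : Submodule ℤ (VP ⧸ Plat) := Submodule.map Plat.mkQ (dualP Plat)

open Finset in
lemma BP_eq (x y : VP) : BP x y = ∑ t : F3, (-2 * x (t,0) * y (t,0) + x (t,0) * y (t,1)
    + x (t,1) * y (t,0) - 2 * x (t,1) * y (t,1)) := by
  unfold BP GP
  rw [Fintype.sum_prod_type]
  refine Finset.sum_congr rfl fun t _ => ?_
  have key : ∀ k : Fin 2, ∑ j : IP, x (t,k) * (if (t,k).1 = j.1 then (if (t,k).2 = j.2 then (-2:ℚ) else 1) else 0) * y j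
      = x (t,k) * (if k = 0 then -2 else 1) * y (t,0) + x (t,k) * (if k = 1 then -2 else 1) * y (t,1) := by
    intro k
    rw [Fintype.sum_prod_type, Finset.sum_eq_single t]
    · simp [Fin.sum_univ_two]
    · intro b _ hb
      simp [Ne.symm hb]
    · simp
  rw [Fin.sum_univ_two, key, key]
  simp
  ring

lemma BP_comm (x y : VP) : BP x y = BP y x := by
  rw [BP_eq, BP_eq]; exact Finset.sum_congr rfl fun t _ => by ring

lemma BP_smul_left (c : ℚ) (a x : VP) : BP (c • a) x = c * BP a x := by
  simp only [BP, Pi.smul_apply, smul_eq_mul, Finset.mul_sum, mul_assoc]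

lemma BP_sub_left (a b x : VP) : BP (a - b) x = BP a x - BP b x := by
  have h : a - b = a + (-1 : ℤ) • b := by simp [sub_eq_add_neg]
  rw [h, BP_add_left, BP_zsmul_left]; push_cast; ring

lemma BP_add_right (a b x : VP) : BP x (a + b) = BP x a + BP x b := by
  rw [BP_comm, BP_add_left, BP_comm a, BP_comm b]
lemma BP_sub_right (a b x : VP) : BP x (a - b) = BP x a - BP x b := by
  rw [BP_comm, BP_sub_left, BP_comm a, BP_comm b]
lemma BP_smul_right (c : ℚ) (a x : VP) : BP x (c • a) = c * BP x a := by
  rw [BP_comm, BP_smul_left, BP_comm a]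

lemma Ev_apply (s : F3) (k : Fin 2) (t : F3) (l : Fin 2) :
    Ev s k (t,l) = if t = s ∧ l = k then 1 else 0 := by
  simp [Ev, Pi.single_apply, Prod.ext_iff]

lemma eL_apply0 (L : Finset F3) (t : F3) : eL L (t,0) = if t ∈ L then 1/3 else 0 := by
  simp [eL, EV, Finset.sum_apply, Ev_apply]

lemma eL_apply1 (L : Finset F3) (t : F3) : eL L (t,1) = if t ∈ L then 2/3 else 0 := by
  simp [eL, EV, Finset.sum_apply, Ev_apply]
  split_ifs <;> norm_num

lemma BP_eL (x : VP) (L : Finset F3) : BP x (eL L) = - ∑ t ∈ L, x (t,1) := by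
  rw [BP_eq, ← Finset.sum_neg_distrib, ← Finset.sum_filter_add_sum_filter_not Finset.univ (· ∈ L)]
  simp only [eL_apply0, eL_apply1]
  rw [Finset.filter_mem_eq_inter, Finset.univ_inter]
  rw [Finset.sum_congr (g := fun t => - x (t,1)) rfl, add_eq_left]
  · apply Finset.sum_eq_zero
    intro t ht
    simp at ht
    simp [ht]
  · intro t ht
    simp [ht]; ring

lemma BP_Ev0 (x : VP) (s : F3) : BP x (Ev s 0) = -2 * x (s,0) + x (s,1) := by
  rw [BP_eq, Finset.sum_eq_single s]
  · simp [Ev_apply]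
  · intro b _ hb; simp [Ev_apply, hb]
  · simp

lemma BP_Ev1 (x : VP) (s : F3) : BP x (Ev s 1) = x (s,0) - 2 * x (s,1) := by
  rw [BP_eq, Finset.sum_eq_single s]
  · simp [Ev_apply]
  · intro b _ hb; simp [Ev_apply, hb]
  · simp

def sg (a : ZMod 3) : ℤ := if a = 0 then 0 else if a = 1 then 1 else -1
def cC (a : ZMod 3) : ℤ := if a = 1 then -2 else 1
def aff (α β γ : ℤ) (t : F3) : ℤ := α * cC t.1 + β * sg t.1 + γ * sg t.2
def ind (p d t : F3) : ℤ := if t ∈ lineF p d then 1 else 0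

lemma line_dec0 : ∀ p d : F3, d ≠ 0 → ∀ t : F3,
    (ind p d t - ind 0 d t - aff (ind p d 0 - ind 0 d 0)
      (ind p d (1,0) - ind 0 d (1,0) - (ind p d 0 - ind 0 d 0))
      (ind p d (0,1) - ind 0 d (0,1) - (ind p d 0 - ind 0 d 0)) t) % 3 = 0 := by
  decide +kernel

lemma line_dec : ∀ p p' d : F3, d ≠ 0 → ∀ t : F3,
    (ind p d t - ind p' d t - aff (ind p d 0 - ind p' d 0)
      (ind p d (1,0) - ind p' d (1,0) - (ind p d 0 - ind p' d 0))
      (ind p d (0,1) - ind p' d (0,1) - (ind p d 0 - ind p' d 0)) t) % 3 = 0 := by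
  intro p p' d hd t
  obtain ⟨a, h1⟩ := Int.dvd_of_emod_eq_zero (line_dec0 p d hd t)
  obtain ⟨b, h2⟩ := Int.dvd_of_emod_eq_zero (line_dec0 p' d hd t)
  apply Int.emod_eq_zero_of_dvd
  refine ⟨a - b, ?_⟩
  simp only [aff] at h1 h2 ⊢
  linear_combination h1 - h2

def PC (x : VP) : Prop := ∃ α β γ : ℤ, ∃ m n : F3 → ℤ, ∀ t,
  x (t,0) = (aff α β γ t : ℚ) / 3 + m t ∧ x (t,1) = 2 * (aff α β γ t : ℚ) / 3 + n t

set_option maxHeartbeats 400000 in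
lemma PC_of_mem {x : VP} (hx : x ∈ Plat) : PC x := by
  refine Submodule.span_induction (p := fun x _ => PC x) ?_ ?_ ?_ ?_ hx
  · rintro x (⟨t, k, rfl⟩ | ⟨L, L', ⟨p, p', d, hd, rfl, rfl⟩, rfl⟩)
    · refine ⟨0, 0, 0, fun s => if s = t ∧ 0 = k then 1 else 0,
        fun s => if s = t ∧ 1 = k then 1 else 0, fun s => ?_⟩
      rw [Ev_apply, Ev_apply]
      simp [aff]
    · have h := line_dec p p' d hd
      set α := ind p d 0 - ind p' d 0
      set β := ind p d (1,0) - ind p' d (1,0) - α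
      set γ := ind p d (0,1) - ind p' d (0,1) - α
      have h2 : ∀ t, ∃ m : ℤ, ind p d t - ind p' d t = aff α β γ t + 3 * m := fun t =>
        ⟨(ind p d t - ind p' d t - aff α β γ t) / 3, by have := h t; omega⟩
      choose m hm using h2
      refine ⟨α, β, γ, m, fun t => 2 * m t, fun t => ?_⟩
      have h3 : ((ind p d t : ℤ) : ℚ) - ind p' d t = aff α β γ t + 3 * m t := by exact_mod_cast hm t
      have h4 : ∀ p, eL (lineF p d) (t,0) = (ind p d t : ℚ) / 3 := fun p => by
        rw [eL_apply0, ind]; split_ifs <;> simp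
      have h5 : ∀ p, eL (lineF p d) (t,1) = 2 * (ind p d t : ℚ) / 3 := fun p => by
        rw [eL_apply1, ind]; split_ifs <;> simp
      rw [Pi.sub_apply, Pi.sub_apply, h4, h4, h5, h5]
      push_cast
      constructor <;> linarith
  · exact ⟨0, 0, 0, 0, 0, fun t => by simp [aff]⟩
  · rintro x y _ _ ⟨α, β, γ, m, n, h⟩ ⟨α', β', γ', m', n', h'⟩
    refine ⟨α + α', β + β', γ + γ', m + m', n + n', fun t => ?_⟩
    simp only [Pi.add_apply, (h t).1, (h t).2, (h' t).1, (h' t).2, aff]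
    push_cast
    constructor <;> ring
  · rintro c x _ ⟨α, β, γ, m, n, h⟩
    refine ⟨c * α, c * β, c * γ, c • m, c • n, fun t => ?_⟩
    simp only [Pi.smul_apply, (h t).1, (h t).2, aff]
    simp only [zsmul_eq_mul, smul_eq_mul]
    push_cast
    constructor <;> ring

lemma Ev_mem (t : F3) (k : Fin 2) : Ev t k ∈ Plat :=
  Submodule.subset_span (Or.inl ⟨t, k, rfl⟩)

lemma eL_sub_mem (p p' d : F3) (hd : d ≠ 0) : eL (lineF p d) - eL (lineF p' d) ∈ Plat :=
  Submodule.subset_span (Or.inr ⟨_, _, ⟨p, p', d, hd, rfl, rfl⟩, rfl⟩)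

lemma int_mem (x : VP) (m n : F3 → ℤ) (h : ∀ t, x (t,0) = m t ∧ x (t,1) = n t) : x ∈ Plat := by
  have : x = ∑ t : F3, (m t • Ev t 0 + n t • Ev t 1) := by
    funext ⟨t, k⟩
    rw [Finset.sum_apply]
    simp only [Pi.add_apply, Pi.smul_apply, Ev_apply]
    rw [Finset.sum_eq_single t]
    · fin_cases k
      · simp [(h t).1]
      · simp [(h t).2]
    · intro b _ hb; simp [Ne.symm hb]
    · simp
  rw [this]
  exact Submodule.sum_mem _ fun t _ => Submodule.add_mem _
    (Submodule.smul_mem _ _ (Ev_mem _ _)) (Submodule.smul_mem _ _ (Ev_mem _ _))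

lemma ind_dec : ∀ t : F3, (cC t.1 = ind (0,0) (0,1) t - ind (1,0) (0,1) t - (ind (1,0) (0,1) t - ind (2,0) (0,1) t))
    ∧ sg t.1 = ind (1,0) (0,1) t - ind (2,0) (0,1) t
    ∧ sg t.2 = ind (0,1) (1,0) t - ind (0,2) (1,0) t := by
  decide +kernel

lemma mem_of_PC {x : VP} (hx : PC x) : x ∈ Plat := by
  obtain ⟨α, β, γ, m, n, h⟩ := hx
  have hd : ((0,1) : F3) ≠ 0 := by decide
  have hd' : ((1,0) : F3) ≠ 0 := by decide
  let a0 := eL (lineF (0,0) (0,1)) - eL (lineF (1,0) (0,1))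
  let a1 := eL (lineF (1,0) (0,1)) - eL (lineF (2,0) (0,1))
  let b1 := eL (lineF (0,1) (1,0)) - eL (lineF (0,2) (1,0))
  have e0 : α • (a0 - a1) + β • a1 + γ • b1 ∈ Plat := by
    refine Submodule.add_mem _ (Submodule.add_mem _ (Submodule.smul_mem _ _ (Submodule.sub_mem _ ?_ ?_))
      (Submodule.smul_mem _ _ ?_)) (Submodule.smul_mem _ _ ?_) <;>
    exact eL_sub_mem _ _ _ (by assumption)
  have h4 : ∀ p d t, eL (lineF p d) (t,0) = (ind p d t : ℚ) / 3 := fun p d t => by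
    rw [eL_apply0, ind]; split_ifs <;> simp
  have h5 : ∀ p d t, eL (lineF p d) (t,1) = 2 * (ind p d t : ℚ) / 3 := fun p d t => by
    rw [eL_apply1, ind]; split_ifs <;> simp
  have e1 : x - (α • (a0 - a1) + β • a1 + γ • b1) ∈ Plat := by
    refine int_mem _ m n fun t => ?_
    obtain ⟨i1, i2, i3⟩ := ind_dec t
    simp only [Pi.sub_apply, Pi.add_apply, Pi.smul_apply, a0, a1, b1, h4, h5, (h t).1, (h t).2, aff,
      i1, i2, i3]
    simp only [zsmul_eq_mul]
    push_cast
    constructor <;> ring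
  simpa using Submodule.add_mem _ e1 e0

lemma sumF3 {M : Type*} [AddCommMonoid M] (f : F3 → M) : ∑ t, f t =
   (f (0,0) + f (0,1) + f (0,2)) + (f (1,0) + f (1,1) + f (1,2)) + (f (2,0) + f (2,1) + f (2,2)) := by
  rw [Fintype.sum_prod_type]
  have : ∀ g : ZMod 3 → M, ∑ i, g i = g 0 + g 1 + g 2 := fun g => Fin.sum_univ_three g
  simp only [this]

lemma P_even {x : VP} (hx : x ∈ Plat) : ∃ n : ℤ, BP x x = 2 * n := by
  obtain ⟨α, β, γ, m, n, h⟩ := PC_of_mem hx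
  have h2 : ∀ t, -2 * x (t,0) * x (t,0) + x (t,0) * x (t,1)
    + x (t,1) * x (t,0) - 2 * x (t,1) * x (t,1) = -2/3 * ((aff α β γ t)^2 : ℤ) +
      2 * ((-(aff α β γ t * n t + m t ^2 - m t * n t + n t ^2) : ℤ) : ℚ) := by
    intro t; rw [(h t).1, (h t).2]; push_cast; ring
  have h3 : ∃ k : ℤ, ∑ t, (aff α β γ t)^2 = 3 * k := by
    refine ⟨6*α^2+2*β^2+2*γ^2 -6*α*β, ?_⟩
    rw [sumF3]
    have s2 : sg 2 = -1 := by decide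
    have c2 : cC 2 = 1 := by decide
    have s1 : sg 1 = 1 := by decide
    have c1 : cC 1 = -2 := by decide
    have s0 : sg 0 = 0 := by decide
    have c0 : cC 0 = 1 := by decide
    simp only [aff, s2, c2, s1, c1, s0, c0]
    ring
  obtain ⟨k, hk⟩ := h3
  rw [BP_eq, Finset.sum_congr rfl fun t _ => h2 t, Finset.sum_add_distrib, ← Finset.mul_sum,
    ← Finset.mul_sum, ← Int.cast_sum, ← Int.cast_sum, hk]
  generalize (∑ t, -(aff α β γ t * n t + m t ^2 - m t * n t + n t ^2)) = N
  exact ⟨N - k, by push_cast; ring⟩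

lemma int_of_half {a : ℚ} {l m n : ℤ} {b c : ℚ} (hb : b = 2 * l) (hc : c = 2 * m)
    (h : b + c + 2 * a = 2 * n) : ∃ k : ℤ, a = k := ⟨n - l - m, by push_cast; linarith⟩

lemma P_int {x y : VP} (hx : x ∈ Plat) (hy : y ∈ Plat) : ∃ n : ℤ, BP x y = n := by
  obtain ⟨l, hl⟩ := P_even hx
  obtain ⟨m, hm⟩ := P_even hy
  obtain ⟨n, hn⟩ := P_even (Submodule.add_mem _ hx hy)
  rw [BP_add_left, BP_add_right, BP_add_right, BP_comm y x] at hn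
  exact int_of_half hl hm (n := n) (by linarith)

lemma lines : L12 = {(0,0),(0,1),(0,2)} ∧ L34 = {(0,0),(1,0),(2,0)} ∧ L00 = {(0,0),(1,1),(2,2)}
    ∧ lineF (1,0) (0,1) = {(1,0),(1,1),(1,2)} ∧ lineF (2,0) (0,1) = {(2,0),(2,1),(2,2)}
    ∧ lineF (0,1) (1,0) = {(0,1),(1,1),(2,1)} ∧ lineF (0,2) (1,0) = {(0,2),(1,2),(2,2)}
    ∧ lineF (0,1) (1,1) = {(0,1),(1,2),(2,0)} ∧ lineF (0,2) (1,1) = {(0,2),(1,0),(2,1)} := by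
  decide +kernel

lemma BP_tri (x : VP) (a b c : F3) (hab : a ≠ b) (hac : a ≠ c) (hbc : b ≠ c) :
    BP x (eL {a, b, c}) = -(x (a,1) + x (b,1) + x (c,1)) := by
  rw [BP_eL, Finset.sum_insert (by simp [hab, hac]), Finset.sum_insert (by simp [hbc]),
    Finset.sum_singleton]; ring

lemma BP_L12 (x : VP) : BP x (eL L12) = -(x ((0,0),1) + x ((0,1),1) + x ((0,2),1)) := by
  rw [lines.1]; exact BP_tri _ _ _ _ (by decide) (by decide) (by decide)
lemma BP_L34 (x : VP) : BP x (eL L34) = -(x ((0,0),1) + x ((1,0),1) + x ((2,0),1)) := by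
  rw [lines.2.1]; exact BP_tri _ _ _ _ (by decide) (by decide) (by decide)
lemma BP_L00 (x : VP) : BP x (eL L00) = -(x ((0,0),1) + x ((1,1),1) + x ((2,2),1)) := by
  rw [lines.2.2.1]; exact BP_tri _ _ _ _ (by decide) (by decide) (by decide)

lemma affv (α β γ : ℤ) : aff α β γ (0,0) = α ∧ aff α β γ (0,1) = α + γ ∧ aff α β γ (0,2) = α - γ
   ∧ aff α β γ (1,0) = -2*α + β ∧ aff α β γ (1,1) = -2*α + β+γ ∧ aff α β γ (1,2) = -2*α+β-γ
   ∧ aff α β γ (2,0) = α - β ∧ aff α β γ (2,1) = α - β + γ ∧ aff α β γ (2,2) = α - β-γ := by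
  have s2 : sg 2 = -1 := by decide
  have c2 : cC 2 = 1 := by decide
  have s1 : sg 1 = 1 := by decide
  have c1 : cC 1 = -2 := by decide
  have s0 : sg 0 = 0 := by decide
  have c0 : cC 0 = 1 := by decide
  simp only [aff, s2, c2, s1, c1, s0, c0]
  refine ⟨?_, ?_, ?_, ?_, ?_, ?_, ?_, ?_, ?_⟩ <;> ring

lemma BPL_int {x : VP} (hx : x ∈ Plat) : (∃ n : ℤ, BP (eL L12) x = n) ∧ (∃ n : ℤ, BP (eL L34) x = n)
    ∧ (∃ n : ℤ, BP (eL L00) x = n) := by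
  obtain ⟨α, β, γ, m, n, h⟩ := PC_of_mem hx
  rw [BP_comm, BP_comm _ x, BP_comm _ x, BP_L12, BP_L34, BP_L00]
  obtain ⟨a1, a2, a3, a4, a5, a6, a7, a8, a9⟩ := affv α β γ
  simp only [(h _).2, a1, a2, a3, a4, a5, a6, a7, a8, a9]
  refine ⟨⟨-(2*α + n (0,0) + n (0,1) + n (0,2)), ?_⟩, ⟨-(n (0,0) + n (1,0) + n (2,0)), ?_⟩,
    ⟨-(n (0,0) + n (1,1) + n (2,2)), ?_⟩⟩ <;> push_cast <;> ring

lemma pj_mem : p1 ∈ dualP Plat ∧ p2 ∈ dualP Plat ∧ p3 ∈ dualP Plat := by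
  have a : eL L12 ∈ dualP Plat := fun x hx => (BPL_int hx).1
  have b : eL L34 ∈ dualP Plat := fun x hx => (BPL_int hx).2.1
  have c : eL L00 ∈ dualP Plat := fun x hx => (BPL_int hx).2.2
  exact ⟨add_mem b c, add_mem a b, add_mem a c⟩

lemma eL3 (L : Finset F3) : (3:ℤ) • eL L ∈ Plat := by
  refine int_mem _ (fun t => if t ∈ L then 1 else 0) (fun t => if t ∈ L then 2 else 0) fun t => ?_
  rw [Pi.smul_apply, Pi.smul_apply, eL_apply0, eL_apply1]
  split_ifs <;> simp <;> norm_num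

lemma pj3 : (3:ℤ) • p1 ∈ Plat ∧ (3:ℤ) • p2 ∈ Plat ∧ (3:ℤ) • p3 ∈ Plat := by
  simp only [p1, p2, p3, smul_add]
  exact ⟨add_mem (eL3 _) (eL3 _), add_mem (eL3 _) (eL3 _), add_mem (eL3 _) (eL3 _)⟩

lemma gramL : BP (eL L12) (eL L12) = -2 ∧ BP (eL L34) (eL L34) = -2 ∧ BP (eL L00) (eL L00) = -2 ∧
    BP (eL L12) (eL L34) = -2/3 ∧ BP (eL L12) (eL L00) = -2/3 ∧ BP (eL L34) (eL L00) = -2/3 := by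
  have h : ((0,0) : F3) ∈ L12 ∧ (0,1) ∈ L12 ∧ (0,2) ∈ L12 ∧ (1,0) ∉ L12 ∧ (2,0) ∉ L12 ∧ (1,1) ∉ L12 ∧ (2,2) ∉ L12 ∧
    (0,0) ∈ L34 ∧ (1,0) ∈ L34 ∧ (2,0) ∈ L34 ∧ (1,1) ∉ L34 ∧ (2,2) ∉ L34 ∧
    (0,0) ∈ L00 ∧ (1,1) ∈ L00 ∧ (2,2) ∈ L00 := by decide +kernel
  obtain ⟨h1, h2, h3, h4, h5, h6, h7, h8, h9, h10, h11, h12, h13, h14, h15⟩ := h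
  simp only [BP_L12, BP_L34, BP_L00, eL_apply1, h1, h2, h3, h4, h5, h6, h7, h8, h9, h10, h11, h12, h13, h14, h15,
    if_true, if_false]
  norm_num

lemma gramp : BP p1 p1 = -16/3 ∧ BP p2 p2 = -16/3 ∧ BP p3 p3 = -16/3 ∧
    BP p1 p2 = -4 ∧ BP p1 p3 = -4 ∧ BP p2 p3 = -4 := by
  obtain ⟨h1, h2, h3, h4, h5, h6⟩ := gramL
  simp only [p1, p2, p3, BP_add_left, BP_add_right, h1, h2, h3, h4, h5, h6,
    BP_comm (eL L34) (eL L12), BP_comm (eL L00) (eL L12), BP_comm (eL L00) (eL L34)]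
  norm_num

set_option maxHeartbeats 2000000 in
lemma mod_aux (a b c d e f x y z n1 n2 n3 n4 n5 n6 q1 q2 q3 : ℤ)
    (k1 : a + b + c - (d + e + f) = 3 * n1) (k2 : a + b + c - (x + y + z) = 3 * n2)
    (k3 : a + d + x - (b + e + y) = 3 * n3) (k4 : a + d + x - (c + f + z) = 3 * n4)
    (k5 : a + e + z - (b + f + x) = 3 * n5) (k6 : a + e + z - (c + d + y) = 3 * n6)
    (j1 : (a + d + x) + (a + e + z) = 3 * q1) (j2 : (a + b + c) + (a + d + x) = 3 * q2)
    (j3 : (a + b + c) + (a + e + z) = 3 * q3) :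
    (a - a) % 3 = 0 ∧ (b - (a + (b - a))) % 3 = 0 ∧ (c - (a - (b - a))) % 3 = 0 ∧
    (d - (-2*a + (d-a))) % 3 = 0 ∧ (e - (-2*a + (d-a) + (b-a))) % 3 = 0 ∧
    (f - (-2*a + (d-a) - (b-a))) % 3 = 0 ∧ (x - (a - (d-a))) % 3 = 0 ∧
    (y - (a - (d-a) + (b-a))) % 3 = 0 ∧ (z - (a - (d-a) - (b-a))) % 3 = 0 := by
  refine ⟨?_, ?_, ?_, ?_, ?_, ?_, ?_, ?_, ?_⟩ <;> omega

set_option maxHeartbeats 1000000 in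
/-- Key fact: an element of `P*` pairing integrally with the `p_j` lies in `P`. -/
lemma mem_P {z : VP} (hz : z ∈ dualP Plat) (h1 : ∃ n : ℤ, BP z p1 = n) (h2 : ∃ n : ℤ, BP z p2 = n)
    (h3 : ∃ n : ℤ, BP z p3 = n) : z ∈ Plat := by
  have hr : ∀ t, ∃ r : ℤ, -2 * z (t,0) + z (t,1) = r := fun t => by
    obtain ⟨n, hn⟩ := hz _ (Ev_mem t 0); exact ⟨n, by rw [← hn, BP_Ev0]⟩
  have hs : ∀ t, ∃ r : ℤ, z (t,0) - 2 * z (t,1) = r := fun t => by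
    obtain ⟨n, hn⟩ := hz _ (Ev_mem t 1); exact ⟨n, by rw [← hn, BP_Ev1]⟩
  choose r hr using hr
  choose s hs using hs
  obtain ⟨g, hg⟩ : ∃ g : F3 → ℤ, ∀ t, g t = r t + 2 * s t := ⟨_, fun t => rfl⟩
  have hg' : ∀ t, (g t : ℚ) = r t + 2 * s t := fun t => by rw [hg]; push_cast; ring
  have z1 : ∀ t, z (t,1) = - (g t : ℚ) / 3 := fun t => by rw [hg']; linarith [hr t, hs t]
  have z0 : ∀ t, z (t,0) = (g t : ℚ) / 3 - (r t + s t) := fun t => by rw [hg']; linarith [hr t, hs t]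
  obtain ⟨l1, l2, l3, l4, l5, l6, l7, l8, l9⟩ := lines
  have d1 : ((0,1) : F3) ≠ 0 := by decide
  have d2 : ((1,0) : F3) ≠ 0 := by decide
  have d3 : ((1,1) : F3) ≠ 0 := by decide
  have key : ∀ p p' d : F3, d ≠ 0 → ∀ a b c a' b' c' : F3, lineF p d = {a,b,c} → lineF p' d = {a',b',c'} →
      a ≠ b ∧ a ≠ c ∧ b ≠ c → a' ≠ b' ∧ a' ≠ c' ∧ b' ≠ c' →
      ∃ n : ℤ, g a + g b + g c - (g a' + g b' + g c') = 3 * n := by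
    intro p p' d hd a b c a' b' c' e e' hh hh'
    obtain ⟨n, hn⟩ := hz _ (eL_sub_mem p p' d hd)
    rw [e, e', BP_sub_right, BP_tri _ _ _ _ hh.1 hh.2.1 hh.2.2, BP_tri _ _ _ _ hh'.1 hh'.2.1 hh'.2.2] at hn
    simp only [z1] at hn
    refine ⟨n, ?_⟩
    have : (g a + g b + g c - (g a' + g b' + g c') : ℚ) = 3 * n := by linarith
    exact_mod_cast this
  obtain ⟨n1, k1⟩ := key (0,0) (1,0) (0,1) d1 _ _ _ _ _ _ l1 l4 (by decide) (by decide)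
  obtain ⟨n2, k2⟩ := key (0,0) (2,0) (0,1) d1 _ _ _ _ _ _ l1 l5 (by decide) (by decide)
  obtain ⟨n3, k3⟩ := key (0,0) (0,1) (1,0) d2 _ _ _ _ _ _ l2 l6 (by decide) (by decide)
  obtain ⟨n4, k4⟩ := key (0,0) (0,2) (1,0) d2 _ _ _ _ _ _ l2 l7 (by decide) (by decide)
  obtain ⟨n5, k5⟩ := key (0,0) (0,1) (1,1) d3 _ _ _ _ _ _ l3 l8 (by decide) (by decide)
  obtain ⟨n6, k6⟩ := key (0,0) (0,2) (1,1) d3 _ _ _ _ _ _ l3 l9 (by decide) (by decide)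
  obtain ⟨q1, h1⟩ := h1
  obtain ⟨q2, h2⟩ := h2
  obtain ⟨q3, h3⟩ := h3
  simp only [p1, p2, p3, BP_add_right, BP_L12, BP_L34, BP_L00, z1] at h1 h2 h3
  have j1 : (g (0,0) + g (1,0) + g (2,0)) + (g (0,0) + g (1,1) + g (2,2)) = 3 * q1 := by
    have : ((g (0,0) + g (1,0) + g (2,0)) + (g (0,0) + g (1,1) + g (2,2)) : ℚ) = 3 * q1 := by linarith
    exact_mod_cast this
  have j2 : (g (0,0) + g (0,1) + g (0,2)) + (g (0,0) + g (1,0) + g (2,0)) = 3 * q2 := by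
    have : ((g (0,0) + g (0,1) + g (0,2)) + (g (0,0) + g (1,0) + g (2,0)) : ℚ) = 3 * q2 := by linarith
    exact_mod_cast this
  have j3 : (g (0,0) + g (0,1) + g (0,2)) + (g (0,0) + g (1,1) + g (2,2)) = 3 * q3 := by
    have : ((g (0,0) + g (0,1) + g (0,2)) + (g (0,0) + g (1,1) + g (2,2)) : ℚ) = 3 * q3 := by linarith
    exact_mod_cast this
  clear h1 h2 h3 key
  have aux := mod_aux _ _ _ _ _ _ _ _ _ _ _ _ _ _ _ _ _ _ k1 k2 k3 k4 k5 k6 j1 j2 j3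
  have fin : ∀ t, ∃ e : ℤ, g t = aff (g (0,0)) (g (1,0) - g (0,0)) (g (0,1) - g (0,0)) t + 3 * e := by
    obtain ⟨a1, a2, a3, a4, a5, a6, a7, a8, a9⟩ := affv (g (0,0)) (g (1,0) - g (0,0)) (g (0,1) - g (0,0))
    have all : ∀ Q : F3 → Prop, Q (0,0) → Q (0,1) → Q (0,2) → Q (1,0) → Q (1,1) → Q (1,2) →
        Q (2,0) → Q (2,1) → Q (2,2) → ∀ t, Q t := by
      rintro Q _ _ _ _ _ _ _ _ _ ⟨a, b⟩
      fin_cases a <;> fin_cases b <;> assumption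
    have dv : ∀ a b : ℤ, (a - b) % 3 = 0 → ∃ e : ℤ, a = b + 3 * e := fun a b h => ⟨(a-b)/3, by omega⟩
    apply all <;> apply dv
    · rw [a1]; exact aux.1
    · rw [a2]; exact aux.2.1
    · rw [a3]; exact aux.2.2.1
    · rw [a4]; exact aux.2.2.2.1
    · rw [a5]; exact aux.2.2.2.2.1
    · rw [a6]; exact aux.2.2.2.2.2.1
    · rw [a7]; exact aux.2.2.2.2.2.2.1
    · rw [a8]; exact aux.2.2.2.2.2.2.2.1
    · rw [a9]; exact aux.2.2.2.2.2.2.2.2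
  choose e he using fin
  refine mem_of_PC ⟨g (0,0), g (1,0) - g (0,0), g (0,1) - g (0,0), fun t => e t - (r t + s t), fun t => 2 * e t - g t, fun t => ?_⟩
  have := congrArg (fun n : ℤ => (n:ℚ)) (he t)
  simp only [Int.cast_add, Int.cast_mul] at this
  rw [z0, z1]
  push_cast at this ⊢
  constructor <;> linarith

lemma BK_eq (x y : VK) : BK x y = 2 * x 0 * y 0 + x 0 * y 1 + x 1 * y 0 + 2 * x 1 * y 1
    + 3 * x 2 * y 3 + 3 * x 3 * y 2 := by
  simp [BK, GK, Fin.sum_univ_four]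
  ring

lemma BK_comm (x y : VK) : BK x y = BK y x := by
  rw [BK_eq, BK_eq]; ring
lemma BK_smul_left (c : ℚ) (a x : VK) : BK (c • a) x = c * BK a x := by
  simp only [BK, Pi.smul_apply, smul_eq_mul, Finset.mul_sum, mul_assoc]
lemma BK_sub_left (a b x : VK) : BK (a - b) x = BK a x - BK b x := by
  simp only [BK_eq, Pi.sub_apply]; ring
lemma BK_add_right (a b x : VK) : BK x (a + b) = BK x a + BK x b := by
  rw [BK_comm, BK_add_left, BK_comm a, BK_comm b]
lemma BK_sub_right (a b x : VK) : BK x (a - b) = BK x a - BK x b := by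
  rw [BK_comm, BK_sub_left, BK_comm a, BK_comm b]
lemma BK_smul_right (c : ℚ) (a x : VK) : BK x (c • a) = c * BK x a := by
  rw [BK_comm, BK_smul_left, BK_comm a]

lemma mem_Klat (x : VK) : x ∈ Klat ↔ ∃ m : Fin 4 → ℤ, ∀ i, x i = (m i : ℚ) := by
  constructor
  · intro hx
    refine Submodule.span_induction (p := fun x _ => ∃ m : Fin 4 → ℤ, ∀ i, x i = (m i : ℚ)) ?_ ?_ ?_ ?_ hx
    · rintro _ ⟨j, rfl⟩
      exact ⟨Pi.single j 1, fun i => by simp only [kappa, Pi.single_apply]; split_ifs <;> simp⟩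
    · exact ⟨0, fun i => by simp⟩
    · rintro x y _ _ ⟨m, hm⟩ ⟨n, hn⟩
      exact ⟨m + n, fun i => by simp [hm, hn]⟩
    · rintro c x _ ⟨m, hm⟩
      exact ⟨c • m, fun i => by simp [hm]⟩
  · rintro ⟨m, hm⟩
    have : x = ∑ i, m i • kappa i := by
      funext j
      rw [Finset.sum_apply, Finset.sum_eq_single j]
      · simp [kappa, hm]
      · intro b _ hb; simp [kappa, Pi.single_apply, Ne.symm hb]
      · simp
    rw [this]
    exact Submodule.sum_mem _ fun i _ => Submodule.smul_mem _ _ (Submodule.subset_span ⟨i, rfl⟩)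

lemma kv1 : k1 = ![2/3, -1/3, 1/3, 1/3] := by
  funext i; fin_cases i <;> simp [k1, kappa] <;> norm_num
lemma kv2 : k2 = ![0, 0, 1/3, -1/3] := by
  funext i; fin_cases i <;> simp [k2, kappa] <;> norm_num
lemma kv3 : k3 = ![2/3, -1/3, -1/3, -1/3] := by
  funext i; fin_cases i <;> simp [k3, kappa] <;> norm_num

lemma BKk1 (x : VK) : BK x k1 = x 0 + x 2 + x 3 := by rw [BK_eq, kv1]; simp; ring
lemma BKk2 (x : VK) : BK x k2 = x 3 - x 2 := by rw [BK_eq, kv2]; simp; ring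
lemma BKk3 (x : VK) : BK x k3 = x 0 - x 2 - x 3 := by rw [BK_eq, kv3]; simp; ring

lemma gramk : BK k1 k1 = 4/3 ∧ BK k2 k2 = -2/3 ∧ BK k3 k3 = 4/3 ∧
    BK k1 k2 = 0 ∧ BK k1 k3 = 0 ∧ BK k2 k3 = 0 := by
  rw [BKk1, BKk2, BKk3, BKk2, BKk3, BKk3, kv1, kv2, kv3]
  simp; norm_num

lemma kappa_mem (i : Fin 4) : kappa i ∈ Klat := Submodule.subset_span ⟨i, rfl⟩

lemma mem_dualK (x : VK) : x ∈ dualK Klat ↔ ∃ a b c d : ℤ, 2 * x 0 + x 1 = a ∧ x 0 + 2 * x 1 = b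
    ∧ 3 * x 2 = c ∧ 3 * x 3 = d := by
  constructor
  · intro hx
    obtain ⟨a, ha⟩ := hx _ (kappa_mem 0)
    obtain ⟨b, hb⟩ := hx _ (kappa_mem 1)
    obtain ⟨c, hc⟩ := hx _ (kappa_mem 3)
    obtain ⟨d, hd⟩ := hx _ (kappa_mem 2)
    refine ⟨a, b, c, d, ?_, ?_, ?_, ?_⟩
    · rw [← ha, BK_eq]; simp [kappa]
    · rw [← hb, BK_eq]; simp [kappa]
    · rw [← hc, BK_eq]; simp [kappa]
    · rw [← hd, BK_eq]; simp [kappa]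
  · rintro ⟨a, b, c, d, ha, hb, hc, hd⟩ y hy
    obtain ⟨m, hm⟩ := (mem_Klat y).1 hy
    refine ⟨a * m 0 + b * m 1 + c * m 3 + d * m 2, ?_⟩
    rw [BK_eq]; push_cast; rw [← ha, ← hb, ← hc, ← hd, hm, hm, hm, hm]; ring

lemma kj_mem : k1 ∈ dualK Klat ∧ k2 ∈ dualK Klat ∧ k3 ∈ dualK Klat := by
  simp only [mem_dualK, kv1, kv2, kv3]
  refine ⟨⟨1, 0, 1, 1, ?_⟩, ⟨0, 0, 1, -1, ?_⟩, ⟨1, 0, -1, -1, ?_⟩⟩ <;> simp <;> norm_num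

lemma kj3 : (3:ℤ) • k1 ∈ Klat ∧ (3:ℤ) • k2 ∈ Klat ∧ (3:ℤ) • k3 ∈ Klat := by
  simp only [mem_Klat, kv1, kv2, kv3]
  refine ⟨⟨![2,-1,1,1], ?_⟩, ⟨![0,0,1,-1], ?_⟩, ⟨![2,-1,-1,-1], ?_⟩⟩ <;> intro i <;> fin_cases i <;>
    simp <;> norm_num

/-- integrality -/
def II (a : ℚ) : Prop := ∃ n : ℤ, a = n
lemma II.add {a b : ℚ} (ha : II a) (hb : II b) : II (a + b) := by
  obtain ⟨m, rfl⟩ := ha; obtain ⟨n, rfl⟩ := hb; exact ⟨m + n, by push_cast; ring⟩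
lemma II.mul {a b : ℚ} (ha : II a) (hb : II b) : II (a * b) := by
  obtain ⟨m, rfl⟩ := ha; obtain ⟨n, rfl⟩ := hb; exact ⟨m * n, by push_cast; ring⟩
lemma II.sub {a b : ℚ} (ha : II a) (hb : II b) : II (a - b) := by
  obtain ⟨m, rfl⟩ := ha; obtain ⟨n, rfl⟩ := hb; exact ⟨m - n, by push_cast; ring⟩

lemma mem_K {z : VK} (hz : z ∈ dualK Klat) (h1 : II (BK z k1)) (h2 : II (BK z k2))
    (h3 : II (BK z k3)) : z ∈ Klat := by
  obtain ⟨a, b, c, d, ha, hb, hc, hd⟩ := (mem_dualK z).1 hz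
  obtain ⟨q1, h1⟩ := h1
  obtain ⟨q2, h2⟩ := h2
  obtain ⟨q3, h3⟩ := h3
  rw [BKk1] at h1
  rw [BKk2] at h2
  rw [BKk3] at h3
  have e0 : z 0 = ((2 * (q1 + q3) - (2 * a - b) : ℤ) : ℚ) := by push_cast; linarith
  have e3 : z 3 = ((-d + (q1 - q3) + 2 * q2 : ℤ) : ℚ) := by push_cast; linarith
  have e2 : z 2 = ((-d + (q1 - q3) + q2 : ℤ) : ℚ) := by push_cast; linarith
  have e1 : z 1 = ((a - 2 * (2 * (q1 + q3) - (2 * a - b)) : ℤ) : ℚ) := by push_cast at e0 ⊢; linarith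
  refine (mem_Klat z).2 ⟨![2 * (q1 + q3) - (2 * a - b), a - 2 * (2 * (q1 + q3) - (2 * a - b)), -d + (q1 - q3) + q2, -d + (q1 - q3) + 2 * q2], fun i => ?_⟩
  fin_cases i
  · exact e0
  · exact e1
  · exact e2
  · exact e3

lemma K_even {x : VK} (hx : x ∈ Klat) : ∃ n : ℤ, BK x x = 2 * n := by
  obtain ⟨m, hm⟩ := (mem_Klat x).1 hx
  refine ⟨m 0 ^ 2 + m 0 * m 1 + m 1 ^ 2 + 3 * m 2 * m 3, ?_⟩
  rw [BK_eq, hm, hm, hm, hm]; push_cast; ring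

lemma K_le {x : VK} (hx : x ∈ Klat) : x ∈ dualK Klat := by
  obtain ⟨m, hm⟩ := (mem_Klat x).1 hx
  rw [mem_dualK]
  exact ⟨2 * m 0 + m 1, m 0 + 2 * m 1, 3 * m 2, 3 * m 3, by simp [hm], by simp [hm], by simp [hm], by simp [hm]⟩

lemma P_le {x : VP} (hx : x ∈ Plat) : x ∈ dualP Plat := fun _ hy => P_int hx hy

lemma c_int {x : VK} (hx : x ∈ dualK Klat) : II (3 * BK x k1) ∧ II (3 * BK x k2) ∧ II (3 * BK x k3) := by
  have h : ∀ k : VK, (3:ℤ) • k ∈ Klat → II (3 * BK x k) := fun k hk => by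
    obtain ⟨n, hn⟩ := hx _ hk
    refine ⟨n, ?_⟩
    rw [← hn, BK_comm x ((3:ℤ) • k), BK_zsmul_left, BK_comm]; push_cast; ring
  exact ⟨h _ kj3.1, h _ kj3.2.1, h _ kj3.2.2⟩

lemma d_int {x : VP} (hx : x ∈ dualP Plat) : II (3 * BP x p1) ∧ II (3 * BP x p2) ∧ II (3 * BP x p3) := by
  have h : ∀ k : VP, (3:ℤ) • k ∈ Plat → II (3 * BP x k) := fun k hk => by
    obtain ⟨n, hn⟩ := hx _ hk
    refine ⟨n, ?_⟩
    rw [← hn, BP_comm x ((3:ℤ) • k), BP_zsmul_left, BP_comm]; push_cast; ring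
  exact ⟨h _ pj3.1, h _ pj3.2.1, h _ pj3.2.2⟩

def GG : VK →ₗ[ℚ] VP where
  toFun x := (3 * BK x k1) • p1 + (3 * BK x k2) • p2 + (3 * BK x k3) • p3
  map_add' x y := by simp only [BK_add_left, mul_add, add_smul]; abel
  map_smul' c x := by
    simp only [BK_smul_left, smul_add, smul_smul, RingHom.id_apply]
    congr 1; congr 1
    all_goals congr 1; ring

def HH : VP →ₗ[ℚ] VK where
  toFun y := (-3 * BP y p1) • k1 + (-3 * BP y p2) • k2 + (-3 * BP y p3) • k3
  map_add' x y := by simp only [BP_add_left, mul_add, add_smul]; abel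
  map_smul' c x := by
    simp only [BP_smul_left, smul_add, smul_smul, RingHom.id_apply]
    congr 1; congr 1
    all_goals congr 1; ring

lemma GG_apply (x : VK) : GG x = (3 * BK x k1) • p1 + (3 * BK x k2) • p2 + (3 * BK x k3) • p3 := rfl
lemma HH_apply (y : VP) : HH y = (-3 * BP y p1) • k1 + (-3 * BP y p2) • k2 + (-3 * BP y p3) • k3 := rfl

lemma BP_GG (x : VK) (y : VP) : BP (GG x) y = 3 * BK x k1 * BP p1 y + 3 * BK x k2 * BP p2 y
    + 3 * BK x k3 * BP p3 y := by
  rw [GG_apply, BP_add_left, BP_add_left, BP_smul_left, BP_smul_left, BP_smul_left]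
lemma BK_HH (y : VP) (x : VK) : BK (HH y) x = -3 * BP y p1 * BK k1 x + -3 * BP y p2 * BK k2 x
    + -3 * BP y p3 * BK k3 x := by
  rw [HH_apply, BK_add_left, BK_add_left, BK_smul_left, BK_smul_left, BK_smul_left]

lemma smul_mem_of_II {M : Type*} [AddCommGroup M] [Module ℚ M] (S : Submodule ℤ M) {c : ℚ} (hc : II c)
    {v : M} (hv : v ∈ S) : c • v ∈ S := by
  obtain ⟨n, rfl⟩ := hc
  rw [Int.cast_smul_eq_zsmul]
  exact S.smul_mem _ hv

lemma GG_dual {x : VK} (hx : x ∈ dualK Klat) : GG x ∈ dualP Plat := by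
  obtain ⟨h1, h2, h3⟩ := c_int hx
  obtain ⟨i1, i2, i3⟩ := pj_mem
  exact add_mem (add_mem (smul_mem_of_II _ h1 i1) (smul_mem_of_II _ h2 i2)) (smul_mem_of_II _ h3 i3)

lemma II_neg {a : ℚ} (h : II (3 * a)) : II (-3 * a) := by
  obtain ⟨n, hn⟩ := h; exact ⟨-n, by push_cast; linarith⟩

lemma HH_dual {y : VP} (hy : y ∈ dualP Plat) : HH y ∈ dualK Klat := by
  obtain ⟨h1, h2, h3⟩ := d_int hy
  obtain ⟨i1, i2, i3⟩ := kj_mem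
  exact add_mem (add_mem (smul_mem_of_II _ (II_neg h1) i1) (smul_mem_of_II _ (II_neg h2) i2))
    (smul_mem_of_II _ (II_neg h3) i3)

lemma GG_lat {x : VK} (hx : x ∈ Klat) : GG x ∈ Plat := by
  obtain ⟨i1, i2, i3⟩ := pj3
  obtain ⟨j1, j2, j3⟩ := kj_mem
  have h : ∀ k ∈ dualK Klat, ∀ p : VP, (3:ℤ) • p ∈ Plat → (3 * BK x k) • p ∈ Plat := by
    intro k hk p hp
    obtain ⟨n, hn⟩ := hk x hx
    have : (3 * BK x k) • p = n • ((3:ℤ) • p) := by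
      rw [BK_comm, hn, smul_smul, ← Int.cast_smul_eq_zsmul ℚ]; push_cast; rw [mul_comm]
    rw [this]; exact Submodule.smul_mem _ _ hp
  exact add_mem (add_mem (h _ j1 _ i1) (h _ j2 _ i2)) (h _ j3 _ i3)

lemma HH_lat {y : VP} (hy : y ∈ Plat) : HH y ∈ Klat := by
  obtain ⟨i1, i2, i3⟩ := kj3
  obtain ⟨j1, j2, j3⟩ := pj_mem
  have h : ∀ p ∈ dualP Plat, ∀ k : VK, (3:ℤ) • k ∈ Klat → (-3 * BP y p) • k ∈ Klat := by
    intro p hp k hk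
    obtain ⟨n, hn⟩ := hp y hy
    have : (-3 * BP y p) • k = (-n) • ((3:ℤ) • k) := by
      rw [BP_comm, hn, smul_smul, ← Int.cast_smul_eq_zsmul ℚ]; push_cast; congr 1; ring
    rw [this]; exact Submodule.smul_mem _ _ hk
  exact add_mem (add_mem (h _ j1 _ i1) (h _ j2 _ i2)) (h _ j3 _ i3)

lemma II_cast (n : ℤ) : II n := ⟨n, rfl⟩
lemma II4 : II (-4) := ⟨-4, by norm_num⟩
lemma II5 : II (-5) := ⟨-5, by norm_num⟩

/-- `⟨G x, p_j⟩ ≡ -⟨x, k_j⟩` -/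
lemma BP_GG_p {x : VK} (hx : x ∈ dualK Klat) : II (BP (GG x) p1 + BK x k1) ∧ II (BP (GG x) p2 + BK x k2) ∧
    II (BP (GG x) p3 + BK x k3) := by
  obtain ⟨⟨c1, h1⟩, ⟨c2, h2⟩, ⟨c3, h3⟩⟩ := c_int hx
  obtain ⟨g1, g2, g3, g4, g5, g6⟩ := gramp
  rw [BP_GG, BP_GG, BP_GG, BP_comm p2 p1, BP_comm p3 p1, BP_comm p3 p2, g1, g2, g3, g4, g5, g6]
  exact ⟨⟨-5 * c1 - 4 * c2 - 4 * c3, by push_cast; linarith⟩,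
    ⟨-4 * c1 - 5 * c2 - 4 * c3, by push_cast; linarith⟩,
    ⟨-4 * c1 - 4 * c2 - 5 * c3, by push_cast; linarith⟩⟩

lemma BK_HH_k {y : VP} (hy : y ∈ dualP Plat) : II (BK (HH y) k1 + BP y p1) ∧ II (BK (HH y) k2 + BP y p2) ∧
    II (BK (HH y) k3 + BP y p3) := by
  obtain ⟨⟨c1, h1⟩, ⟨c2, h2⟩, ⟨c3, h3⟩⟩ := d_int hy
  obtain ⟨g1, g2, g3, g4, g5, g6⟩ := gramk
  rw [BK_HH, BK_HH, BK_HH, BK_comm k2 k1, BK_comm k3 k1, BK_comm k3 k2, g1, g2, g3, g4, g5, g6]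
  exact ⟨⟨-c1, by push_cast; linarith⟩,
    ⟨c2, by push_cast; linarith⟩,
    ⟨-c3, by push_cast; linarith⟩⟩

lemma GH {y : VP} (hy : y ∈ dualP Plat) : GG (HH y) - y ∈ Plat := by
  obtain ⟨a1, a2, a3⟩ := BP_GG_p (HH_dual hy)
  obtain ⟨b1, b2, b3⟩ := BK_HH_k hy
  refine mem_P (sub_mem (GG_dual (HH_dual hy)) hy) ?_ ?_ ?_ <;> rw [BP_sub_left] <;> change II _
  · convert a1.sub b1 using 1; ring
  · convert a2.sub b2 using 1; ring
  · convert a3.sub b3 using 1; ring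

lemma HG {x : VK} (hx : x ∈ dualK Klat) : HH (GG x) - x ∈ Klat := by
  obtain ⟨a1, a2, a3⟩ := BK_HH_k (GG_dual hx)
  obtain ⟨b1, b2, b3⟩ := BP_GG_p hx
  refine mem_K (sub_mem (HH_dual (GG_dual hx)) hx) ?_ ?_ ?_ <;> rw [BK_sub_left]
  · convert a1.sub b1 using 1; ring
  · convert a2.sub b2 using 1; ring
  · convert a3.sub b3 using 1; ring

/-- characterization of the gluing relation -/
lemma rel_iff {x : VK} (hx : x ∈ dualK Klat) {y : VP} (hy : y ∈ dualP Plat) :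
    GG x - y ∈ Plat ↔ II (BK x k1 + BP y p1) ∧ II (BK x k2 + BP y p2) ∧ II (BK x k3 + BP y p3) := by
  obtain ⟨b1, b2, b3⟩ := BP_GG_p hx
  constructor
  · intro h
    obtain ⟨j1, j2, j3⟩ := pj_mem
    have i1 : II (BP (GG x - y) p1) := by rw [BP_comm]; exact j1 _ h
    have i2 : II (BP (GG x - y) p2) := by rw [BP_comm]; exact j2 _ h
    have i3 : II (BP (GG x - y) p3) := by rw [BP_comm]; exact j3 _ h
    rw [BP_sub_left] at i1 i2 i3
    refine ⟨?_, ?_, ?_⟩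
    · convert b1.sub i1 using 1; ring
    · convert b2.sub i2 using 1; ring
    · convert b3.sub i3 using 1; ring
  · rintro ⟨i1, i2, i3⟩
    refine mem_P (sub_mem (GG_dual hx) hy) ?_ ?_ ?_ <;> rw [BP_sub_left] <;> change II _
    · convert b1.sub i1 using 1; ring
    · convert b2.sub i2 using 1; ring
    · convert b3.sub i3 using 1; ring

/-- `q_P(γ x) = - q_K x` -/
lemma q_rel {x : VK} (hx : x ∈ dualK Klat) {y : VP} (h : GG x - y ∈ Plat) :
    ∃ n : ℤ, BP y y = -BK x x + 2 * n := by
  obtain ⟨⟨c1, h1⟩, ⟨c2, h2⟩, ⟨c3, h3⟩⟩ := c_int hx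
  obtain ⟨g1, g2, g3, g4, g5, g6⟩ := gramp
  obtain ⟨l1, l2, l3, l4, l5, l6⟩ := gramk
  obtain ⟨e, he⟩ := P_even h
  obtain ⟨f, hf⟩ := GG_dual hx _ h
  obtain ⟨w, hw⟩ : ∃ w, w = GG x - y := ⟨_, rfl⟩
  rw [← hw] at he hf
  have hy : y = GG x - w := by rw [hw]; abel
  have GGG : BP (GG x) (GG x) = -16/3 * (c1^2 + c2^2 + c3^2) - 8 * (c1*c2 + c1*c3 + c2*c3) := by
    rw [BP_GG, BP_comm p1, BP_comm p2, BP_comm p3, BP_GG, BP_GG, BP_GG, BP_comm p2 p1, BP_comm p3 p1,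
      BP_comm p3 p2, g1, g2, g3, g4, g5, g6, h1, h2, h3]
    ring
  obtain ⟨s, hs⟩ : ∃ s, s = (c1:ℚ) • k1 + (c2:ℚ) • k2 + (c3:ℚ) • k3 := ⟨_, rfl⟩
  have sB : ∀ u, BK s u = c1 * BK k1 u + c2 * BK k2 u + c3 * BK k3 u := fun u => by
    rw [hs, BK_add_left, BK_add_left, BK_smul_left, BK_smul_left, BK_smul_left]
  have sd : s ∈ dualK Klat := by
    obtain ⟨i1, i2, i3⟩ := kj_mem
    rw [hs]
    exact add_mem (add_mem (smul_mem_of_II _ ⟨_, rfl⟩ i1) (smul_mem_of_II _ ⟨_, rfl⟩ i2))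
      (smul_mem_of_II _ ⟨_, rfl⟩ i3)
  obtain ⟨κ, hκ⟩ : ∃ κ, κ = x - s := ⟨_, rfl⟩
  have κm : κ ∈ Klat := by
    rw [hκ]
    refine mem_K (sub_mem hx sd) ?_ ?_ ?_ <;>
      rw [BK_sub_left, sB]
    · rw [BK_comm k2 k1, BK_comm k3 k1, l1, l4, l5]; exact ⟨-c1, by push_cast; linarith⟩
    · rw [BK_comm k3 k2, l2, l4, l6]; exact ⟨c2, by push_cast; linarith⟩
    · rw [l3, l5, l6]; exact ⟨-c3, by push_cast; linarith⟩
  obtain ⟨u, hu⟩ := K_even κm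
  obtain ⟨v, hv⟩ := sd _ κm
  have hxs : x = s + κ := by rw [hκ]; abel
  have ss : BK s s = 4/3 * c1^2 - 2/3 * c2^2 + 4/3 * c3^2 := by
    rw [sB, BK_comm k1, BK_comm k2, BK_comm k3, sB, sB, sB, BK_comm k2 k1, BK_comm k3 k1, BK_comm k3 k2,
      l1, l2, l3, l4, l5, l6]; ring
  have xx : BK x x = 4/3 * c1^2 - 2/3 * c2^2 + 4/3 * c3^2 + 2 * v + 2 * u := by
    rw [hxs, BK_add_left, BK_add_right, BK_add_right, BK_comm κ s, ss, hu, hv]; ring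
  have yy : BP y y = -16/3 * (c1^2 + c2^2 + c3^2) - 8 * (c1*c2 + c1*c3 + c2*c3) - 2 * f + 2 * e := by
    rw [hy, BP_sub_left, BP_sub_right, BP_sub_right, BP_comm w, GGG, he, hf]; ring
  refine ⟨-2*c1^2 - 3*c2^2 - 2*c3^2 - 4 * (c1*c2 + c1*c3 + c2*c3) - f + e + v + u, ?_⟩
  rw [xx, yy]; push_cast; ring

def gmap : (VK ⧸ Klat) →ₗ[ℤ] (VP ⧸ Plat) :=
  Klat.mapQ Plat (GG.restrictScalars ℤ) fun _ hx => GG_lat hx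
def hmap : (VP ⧸ Plat) →ₗ[ℤ] (VK ⧸ Klat) :=
  Plat.mapQ Klat (HH.restrictScalars ℤ) fun _ hx => HH_lat hx

lemma gmap_mk (x : VK) : gmap (Klat.mkQ x) = Plat.mkQ (GG x) := rfl
lemma hmap_mk (x : VP) : hmap (Plat.mkQ x) = Klat.mkQ (HH x) := rfl

lemma gmap_mem : ∀ x ∈ DK, gmap x ∈ DP := by
  rintro _ ⟨x, hx, rfl⟩
  exact ⟨GG x, GG_dual hx, rfl⟩
lemma hmap_mem : ∀ x ∈ DP, hmap x ∈ DK := by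
  rintro _ ⟨x, hx, rfl⟩
  exact ⟨HH x, HH_dual hx, rfl⟩

def gam : DK ≃+ DP where
  toFun x := ⟨gmap x, gmap_mem _ x.2⟩
  invFun y := ⟨hmap y, hmap_mem _ y.2⟩
  left_inv := by
    rintro ⟨_, ⟨x, hx, rfl⟩⟩
    apply Subtype.ext
    change Klat.mkQ (HH (GG x)) = Klat.mkQ x
    exact (Submodule.Quotient.eq Klat).2 (HG hx)
  right_inv := by
    rintro ⟨_, ⟨x, hx, rfl⟩⟩
    apply Subtype.ext
    change Plat.mkQ (GG (HH x)) = Plat.mkQ x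
    exact (Submodule.Quotient.eq Plat).2 (GH hx)
  map_add' x y := Subtype.ext (by simp)

lemma gam_iff {x : VK} (hx : x ∈ dualK Klat) {y : VP} (hy : y ∈ dualP Plat) :
    gam ⟨Klat.mkQ x, Submodule.mem_map_of_mem hx⟩ = ⟨Plat.mkQ y, Submodule.mem_map_of_mem hy⟩
      ↔ GG x - y ∈ Plat := by
  rw [Subtype.ext_iff]
  change Plat.mkQ (GG x) = Plat.mkQ y ↔ _
  exact Submodule.Quotient.eq Plat

def Gam : Submodule ℤ (VK × VP) where
  carrier := {v | v.1 ∈ dualK Klat ∧ v.2 ∈ dualP Plat ∧ GG v.1 - v.2 ∈ Plat}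
  zero_mem' := by
    refine ⟨zero_mem _, zero_mem _, ?_⟩
    simp
  add_mem' := by
    rintro a b ⟨h1, h2, h3⟩ ⟨i1, i2, i3⟩
    refine ⟨add_mem h1 i1, add_mem h2 i2, ?_⟩
    have := add_mem h3 i3
    rw [Prod.fst_add, Prod.snd_add, map_add]
    convert this using 1; abel
  smul_mem' := by
    rintro c a ⟨h1, h2, h3⟩
    refine ⟨Submodule.smul_mem _ _ h1, Submodule.smul_mem _ _ h2, ?_⟩
    have := Submodule.smul_mem _ c h3
    rw [Prod.smul_fst, Prod.smul_snd, map_zsmul, ← smul_sub]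
    exact this

lemma Bf_comm (v w : VK × VP) : Bf v w = Bf w v := by
  simp only [Bf]; rw [BK_comm, BP_comm]
lemma Bf_add_left (u v w : VK × VP) : Bf (u + v) w = Bf u w + Bf v w := by
  simp only [Bf, Prod.fst_add, Prod.snd_add, BK_add_left, BP_add_left]; ring
lemma Bf_smul_left (c : ℚ) (v w : VK × VP) : Bf (c • v) w = c * Bf v w := by
  simp only [Bf, Prod.smul_fst, Prod.smul_snd, BK_smul_left, BP_smul_left]; ring
lemma Bf_add_right (u v w : VK × VP) : Bf w (u + v) = Bf w u + Bf w v := by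
  rw [Bf_comm, Bf_add_left, Bf_comm u, Bf_comm v]
lemma Bf_smul_right (c : ℚ) (v w : VK × VP) : Bf w (c • v) = c * Bf w v := by
  rw [Bf_comm, Bf_smul_left, Bf_comm v]

lemma Gam_even {v : VK × VP} (hv : v ∈ Gam) : ∃ n : ℤ, Bf v v = 2 * n := by
  obtain ⟨n, hn⟩ := q_rel hv.1 hv.2.2
  exact ⟨n, by rw [Bf, hn]; ring⟩

lemma Gam_int {v w : VK × VP} (hv : v ∈ Gam) (hw : w ∈ Gam) : ∃ n : ℤ, Bf v w = n := by
  obtain ⟨l, hl⟩ := Gam_even hv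
  obtain ⟨m, hm⟩ := Gam_even hw
  obtain ⟨n, hn⟩ := Gam_even (Submodule.add_mem _ hv hw)
  rw [Bf_add_left, Bf_add_right, Bf_add_right, Bf_comm w v] at hn
  exact int_of_half hl hm (n := n) (by linarith)

lemma K_Gam {x : VK} (hx : x ∈ Klat) : (x, (0 : VP)) ∈ Gam :=
  ⟨K_le hx, zero_mem _, by simpa using GG_lat hx⟩
lemma P_Gam {y : VP} (hy : y ∈ Plat) : ((0 : VK), y) ∈ Gam :=
  ⟨zero_mem _, P_le hy, by simpa using hy⟩

lemma BP_zero_right (x : VP) : BP x 0 = 0 := by rw [BP_comm, BP_zero_left]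
lemma BK_zero_right (x : VK) : BK x 0 = 0 := by rw [BK_comm, BK_zero_left]

lemma kp_rel : GG k1 - p1 ∈ Plat ∧ GG k2 - p2 ∈ Plat ∧ GG k3 - p3 ∈ Plat := by
  obtain ⟨j1, j2, j3⟩ := kj_mem
  obtain ⟨i1, i2, i3⟩ := pj_mem
  obtain ⟨g1, g2, g3, g4, g5, g6⟩ := gramp
  obtain ⟨l1, l2, l3, l4, l5, l6⟩ := gramk
  rw [rel_iff j1 i1, rel_iff j2 i2, rel_iff j3 i3, BK_comm k2 k1, BK_comm k3 k1, BK_comm k3 k2,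
    BP_comm p2 p1, BP_comm p3 p1, BP_comm p3 p2, g1, g2, g3, g4, g5, g6, l1, l2, l3, l4, l5, l6]
  refine ⟨⟨⟨-4, ?_⟩, ⟨-4, ?_⟩, ⟨-4, ?_⟩⟩, ⟨⟨-4, ?_⟩, ⟨-6, ?_⟩, ⟨-4, ?_⟩⟩, ⟨⟨-4, ?_⟩, ⟨-4, ?_⟩, ⟨-4, ?_⟩⟩⟩ <;>
    norm_num

lemma Gam_dual {u : VK × VP} (h : ∀ w ∈ Gam, ∃ n : ℤ, Bf u w = n) : u ∈ Gam := by
  have a : u.1 ∈ dualK Klat := fun x hx => by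
    have := h _ (K_Gam hx)
    simpa only [Bf, BP_zero_right, add_zero] using this
  have b : u.2 ∈ dualP Plat := fun x hx => by
    have := h _ (P_Gam hx)
    simpa only [Bf, BK_zero_right, zero_add] using this
  obtain ⟨j1, j2, j3⟩ := kj_mem
  obtain ⟨i1, i2, i3⟩ := pj_mem
  obtain ⟨r1, r2, r3⟩ := kp_rel
  exact ⟨a, b, (rel_iff a b).2 ⟨h (k1, p1) ⟨j1, i1, r1⟩, h (k2, p2) ⟨j2, i2, r2⟩, h (k3, p3) ⟨j3, i3, r3⟩⟩⟩

def BB : Module.Basis (Fin 4 ⊕ IP) ℚ (VK × VP) := (Pi.basisFun ℚ (Fin 4)).prod (Pi.basisFun ℚ IP)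

lemma BB_inl (i : Fin 4) : BB (Sum.inl i) = (kappa i, 0) := by
  apply Prod.ext
  · simp [BB, kappa]
  · simp [BB]
lemma BB_inr (t : F3) (k : Fin 2) : BB (Sum.inr (t,k)) = (0, Ev t k) := by
  apply Prod.ext
  · simp [BB]
  · simp [BB, Ev]

lemma BB_mem (i : Fin 4 ⊕ IP) : BB i ∈ Gam := by
  rcases i with i | ⟨t, k⟩
  · rw [BB_inl]; exact K_Gam (kappa_mem i)
  · rw [BB_inr]; exact P_Gam (Ev_mem t k)

lemma repr_II {v : VK × VP} (hv : v ∈ Gam) (i : Fin 4 ⊕ IP) : II (3 * BB.repr v i) := by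
  obtain ⟨h1, h2, -⟩ := hv
  rcases i with i | ⟨t, k⟩
  · have : BB.repr v (Sum.inl i) = v.1 i := by simp [BB]
    rw [this]
    obtain ⟨a, b, c, d, ha, hb, hc, hd⟩ := (mem_dualK _).1 h1
    fin_cases i
    · exact ⟨2 * a - b, by push_cast; change 3 * v.1 0 = _; linarith⟩
    · exact ⟨2 * b - a, by push_cast; change 3 * v.1 1 = _; linarith⟩
    · exact ⟨c, hc⟩
    · exact ⟨d, hd⟩
  · have : BB.repr v (Sum.inr (t,k)) = v.2 (t,k) := by simp [BB]
    rw [this]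
    obtain ⟨r, hr⟩ := h2 _ (Ev_mem t 0)
    obtain ⟨s, hs⟩ := h2 _ (Ev_mem t 1)
    rw [BP_Ev0] at hr
    rw [BP_Ev1] at hs
    fin_cases k
    · exact ⟨-(2 * r + s), by push_cast; change 3 * v.2 (t,0) = _; linarith⟩
    · exact ⟨-(r + 2 * s), by push_cast; change 3 * v.2 (t,1) = _; linarith⟩

lemma Gam_fg : Gam.FG := by
  let N : Submodule ℤ (VK × VP) := Submodule.span ℤ (Set.range fun i => (3:ℚ)⁻¹ • BB i)
  have hN : N.FG := Submodule.fg_span (Set.finite_range _)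
  have hle : Gam ≤ N := by
    intro v hv
    rw [← BB.sum_repr v]
    refine Submodule.sum_mem _ fun i _ => ?_
    have : BB.repr v i • BB i = (3 * BB.repr v i) • ((3:ℚ)⁻¹ • BB i) := by
      rw [smul_smul]; congr 1; ring
    rw [this]
    exact smul_mem_of_II _ (repr_II hv i) (Submodule.subset_span ⟨i, rfl⟩)
  have := isNoetherian_of_fg_of_noetherian N hN
  exact isNoetherian_submodule.mp this Gam hle

lemma rank22 : Module.finrank ℚ (VK × VP) = 22 := by
  rw [Module.finrank_eq_card_basis BB]; simp

lemma Gam_basis : ∃ b : Fin 22 → VK × VP, LinearIndependent ℚ b ∧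
    Gam = Submodule.span ℤ (Set.range b) := by
  have : Module.Finite ℤ Gam := Module.Finite.iff_fg.2 Gam_fg
  have : Module.Free ℤ Gam := Module.free_of_finite_type_torsion_free'
  let b := Module.finBasis ℤ Gam
  let b' : Fin (Module.finrank ℤ Gam) → VK × VP := fun i => (b i : VK × VP)
  have li : LinearIndependent ℤ b' := b.linearIndependent.map' Gam.subtype (Submodule.ker_subtype _)
  have liq : LinearIndependent ℚ b' := (LinearIndependent.iff_fractionRing ℤ ℚ).1 li
  have sp : Gam = Submodule.span ℤ (Set.range b') := by
    have h1 : Set.range b' = Gam.subtype '' Set.range b := by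
      rw [← Set.range_comp]; rfl
    rw [h1, ← Submodule.map_span, b.span_eq, Submodule.map_top, Submodule.range_subtype]
  have top : Submodule.span ℚ (Set.range b') = ⊤ := by
    rw [eq_top_iff, ← BB.span_eq, Submodule.span_le]
    rintro _ ⟨i, rfl⟩
    have : BB i ∈ Submodule.span ℤ (Set.range b') := sp ▸ BB_mem i
    exact Submodule.span_subset_span ℤ ℚ _ this
  have hn : Module.finrank ℤ Gam = 22 := by
    have := Module.finrank_eq_card_basis (Module.Basis.mk liq top.ge)
    rw [rank22, Fintype.card_fin] at this
    exact this.symm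
  refine ⟨b' ∘ Fin.cast hn.symm, liq.comp _ (Fin.cast_injective _), ?_⟩
  have : Set.range (b' ∘ Fin.cast hn.symm) = Set.range b' :=
    (finCongr hn.symm).surjective.range_comp b'
  rw [this]; exact sp

def cc : Fin 4 ⊕ IP → VK × VP
  | Sum.inl i => (![kappa 0, kappa 0 - 2 • kappa 1, kappa 2 + kappa 3, kappa 2 - kappa 3] i, 0)
  | Sum.inr (t, k) => (0, if k = 0 then Ev t 0 else EV t)

lemma cc_ortho : ∀ i j, i ≠ j → Bf (cc i) (cc j) = 0 := by
  rintro (i | ⟨t, k⟩) (j | ⟨s, l⟩) h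
  · simp only [cc, Bf, BP_zero_left, add_zero, BK_eq]
    fin_cases i <;> fin_cases j <;> first | (exact absurd rfl h) | (simp [kappa])
  · simp [cc, Bf, BK_zero_right, BP_zero_left]
  · simp [cc, Bf, BK_zero_left, BP_zero_right]
  · simp only [cc, Bf, BK_zero_left, zero_add]
    have e2 : ∀ t, EV t = Ev t 0 + (2:ℚ) • Ev t 1 := fun t => by rw [EV, ofNat_smul_eq_nsmul ℚ]
    by_cases hts : t = s
    · subst hts
      fin_cases k <;> fin_cases l <;> first | (exact absurd rfl h) | skip
      all_goals simp [e2, BP_add_left, BP_add_right, BP_smul_left, BP_smul_right, BP_Ev0, BP_Ev1, Ev_apply]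
    · have hst : ¬ s = t := fun h => hts h.symm
      fin_cases k <;> fin_cases l <;>
        simp [e2, BP_add_left, BP_add_right, BP_smul_left, BP_smul_right, BP_Ev0, BP_Ev1, Ev_apply, hts, hst]

lemma cc_inr (t : IP) : Bf (cc (Sum.inr t)) (cc (Sum.inr t)) < 0 := by
  obtain ⟨t, k⟩ := t
  have e2 : ∀ t, EV t = Ev t 0 + (2:ℚ) • Ev t 1 := fun t => by rw [EV, ofNat_smul_eq_nsmul ℚ]
  simp only [cc, Bf, BK_zero_left, zero_add]
  fin_cases k <;>
    simp [e2, BP_add_left, BP_add_right, BP_smul_left, BP_smul_right, BP_Ev0, BP_Ev1, Ev_apply] <;> norm_num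

lemma cc_pos (i : Fin 4) (hi : (i : ℕ) < 3) : 0 < Bf (cc (Sum.inl i)) (cc (Sum.inl i)) := by
  simp only [cc, Bf, BP_zero_left, add_zero, BK_eq]
  fin_cases i
  · simp [kappa]
  · simp [kappa]; norm_num
  · simp [kappa]
  · simp at hi

lemma cc_neg (i : Fin 4) (hi : 3 ≤ (i : ℕ)) : Bf (cc (Sum.inl i)) (cc (Sum.inl i)) < 0 := by
  simp only [cc, Bf, BP_zero_left, add_zero, BK_eq]
  fin_cases i
  · simp at hi
  · simp at hi
  · simp at hi
  · simp [kappa]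

def BfL : (VK × VP) →ₗ[ℚ] (VK × VP) →ₗ[ℚ] ℚ :=
  LinearMap.mk₂ ℚ Bf Bf_add_left Bf_smul_left (fun w u v => Bf_add_right u v w)
    (fun c w v => Bf_smul_right c v w)

lemma cc_li : LinearIndependent ℚ cc := by
  refine LinearMap.linearIndependent_of_isOrthoᵢ (B := BfL) ?_ ?_
  · intro i j h
    exact cc_ortho i j h
  · intro i h
    have h' : Bf (cc i) (cc i) = 0 := h
    rcases i with i | t
    · by_cases hi : (i : ℕ) < 3
      · exact (cc_pos i hi).ne' h'
      · exact (cc_neg i (by omega)).ne h'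
    · exact (cc_inr t).ne h'

lemma sig : ∃ c : Fin 22 → VK × VP, LinearIndependent ℚ c ∧
          Submodule.span ℚ (Set.range c) = ⊤ ∧
          (∀ i j : Fin 22, i ≠ j → Bf (c i) (c j) = 0) ∧
          (∀ i : Fin 22, (i : ℕ) < 3 → 0 < Bf (c i) (c i)) ∧
          (∀ i : Fin 22, 3 ≤ (i : ℕ) → Bf (c i) (c i) < 0) := by
  let e0 : IP ≃ Fin 18 := Fintype.equivFinOfCardEq (by simp)
  let e : Fin 4 ⊕ IP ≃ Fin 22 := (Equiv.sumCongr (Equiv.refl _) e0).trans finSumFinEquiv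
  have hl : ∀ j : Fin 4, ((e (Sum.inl j) : Fin 22) : ℕ) = j := fun j => rfl
  have hr : ∀ t : IP, ((e (Sum.inr t) : Fin 22) : ℕ) = 4 + e0 t := fun t => rfl
  have li : LinearIndependent ℚ (cc ∘ e.symm) := cc_li.comp _ e.symm.injective
  refine ⟨cc ∘ e.symm, li, ?_, ?_, ?_, ?_⟩
  · exact li.span_eq_top_of_card_eq_finrank' (by rw [rank22]; simp)
  · intro i j h
    exact cc_ortho _ _ (fun h' => h (e.symm.injective h'))
  · intro i hi
    obtain ⟨j, rfl⟩ := e.surjective i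
    simp only [Function.comp, Equiv.symm_apply_apply]
    rcases j with j | t
    · exact cc_pos j (by rw [hl] at hi; exact hi)
    · exfalso
      rw [hr] at hi
      omega
  · intro i hi
    obtain ⟨j, rfl⟩ := e.surjective i
    simp only [Function.comp, Equiv.symm_apply_apply]
    rcases j with j | t
    · exact cc_neg j (by rw [hl] at hi; exact hi)
    · exact cc_inr t

theorem statement6 :
    ∃ (hk : ∀ j : Fin 3, kv j ∈ dualK Klat) (hp : ∀ j : Fin 3, pv j ∈ dualP Plat),
    ∃ γ : DK ≃+ DP,
      -- γ(k_j + K) = p_j + P for j = 1, 2, 3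
      (∀ j : Fin 3, γ ⟨Klat.mkQ (kv j), Submodule.mem_map_of_mem (hk j)⟩ =
          ⟨Plat.mkQ (pv j), Submodule.mem_map_of_mem (hp j)⟩) ∧
      -- q_P(γ(x)) = −q_K(x) for all x ∈ K*/K
      (∀ x, ∀ hx : x ∈ dualK Klat, ∀ y, ∀ hy : y ∈ dualP Plat,
        γ ⟨Klat.mkQ x, Submodule.mem_map_of_mem hx⟩ =
            ⟨Plat.mkQ y, Submodule.mem_map_of_mem hy⟩ →
        ∃ n : ℤ, BP y y = -BK x x + 2 * n) ∧
      -- the glued lattice Γ is an even unimodular lattice of rank 22 and signature (3,19)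
      (∀ Γ : Set (VK × VP),
        Γ = {v | ∃ (hx : v.1 ∈ dualK Klat) (hy : v.2 ∈ dualP Plat),
          γ ⟨Klat.mkQ v.1, Submodule.mem_map_of_mem hx⟩ =
            ⟨Plat.mkQ v.2, Submodule.mem_map_of_mem hy⟩} →
        -- integral
        (∀ v ∈ Γ, ∀ w ∈ Γ, ∃ n : ℤ, Bf v w = n) ∧
        -- even
        (∀ v ∈ Γ, ∃ n : ℤ, Bf v v = 2 * n) ∧
        -- unimodular (self-dual)
        ({u : VK × VP | ∀ w ∈ Γ, ∃ n : ℤ, Bf u w = n} = Γ) ∧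
        -- free of rank 22
        (∃ b : Fin 22 → VK × VP, LinearIndependent ℚ b ∧
          Γ = (Submodule.span ℤ (Set.range b) : Set (VK × VP))) ∧
        -- the ambient quadratic space Γ ⊗ ℚ has signature (3,19)
        (∃ c : Fin 22 → VK × VP, LinearIndependent ℚ c ∧
          Submodule.span ℚ (Set.range c) = ⊤ ∧
          (∀ i j : Fin 22, i ≠ j → Bf (c i) (c j) = 0) ∧
          (∀ i : Fin 22, (i : ℕ) < 3 → 0 < Bf (c i) (c i)) ∧
          (∀ i : Fin 22, 3 ≤ (i : ℕ) → Bf (c i) (c i) < 0))) := by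
  obtain ⟨j1, j2, j3⟩ := kj_mem
  obtain ⟨i1, i2, i3⟩ := pj_mem
  obtain ⟨r1, r2, r3⟩ := kp_rel
  have hk : ∀ j : Fin 3, kv j ∈ dualK Klat := by
    intro j
    fin_cases j
    · exact j1
    · exact j2
    · exact j3
  have hp : ∀ j : Fin 3, pv j ∈ dualP Plat := by
    intro j
    fin_cases j
    · exact i1
    · exact i2
    · exact i3
  refine ⟨hk, hp, gam, ?_, ?_, ?_⟩
  · intro j
    refine (gam_iff (hk j) (hp j)).2 ?_
    fin_cases j
    · exact r1
    · exact r2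
    · exact r3
  · intro x hx y hy h
    exact q_rel hx ((gam_iff hx hy).1 h)
  · intro Γ hΓ
    have hG : Γ = (Gam : Set (VK × VP)) := by
      rw [hΓ]
      ext v
      constructor
      · rintro ⟨hx, hy, h⟩
        exact ⟨hx, hy, (gam_iff hx hy).1 h⟩
      · rintro ⟨hx, hy, h⟩
        exact ⟨hx, hy, (gam_iff hx hy).2 h⟩
    clear hΓ
    subst hG
    refine ⟨fun v hv w hw => Gam_int hv hw, fun v hv => Gam_even hv, ?_, ?_, sig⟩
    · ext u
      exact ⟨fun h => Gam_dual h, fun hu w hw => Gam_int hu hw⟩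
    · obtain ⟨b, hb, h⟩ := Gam_basis
      exact ⟨b, hb, by rw [← h]⟩
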